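/- arXiv:2501.10267 — 3 statements merged into one kernel-verified Lean document; each statement's English description precedes it below -/
import Mathlib

section
/- For every integer e ≥ 1, c_e^{2e} = (2e−1)!!. That is, the number of (2e−1)-dimensional partitions λ ⊆ ℕ^{2e} of size 1+3e with embedding dimension h_λ(1) = 2e and socle contained in λ_{≥2} equals the odd double factorial (2e−1)!!. -/
open Finset

attribute [local instance] Classical.propDecidable

noncomputable section

/-- A finite downward-closed subset of `ℕ^n` (an `(n-1)`-dimensional partition). -/
def IsPartitionFn {n : ℕ} (lam : Finset (Fin n → ℕ)) : Prop :=
  ∀ a ∈ lam, ∀ y : Fin n → ℕ, y ≤ a → y ∈ lam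

/-- Degree of a lattice point. -/
def degFn {n : ℕ} (y : Fin n → ℕ) : ℕ := ∑ i, y i

/-- Hilbert–Samuel function. -/
def hsFn {n : ℕ} (lam : Finset (Fin n → ℕ)) (k : ℕ) : ℕ :=
  (lam.filter fun a => degFn a = k).card

/-- Socle: maximal elements. -/
def socleFn {n : ℕ} (lam : Finset (Fin n → ℕ)) : Finset (Fin n → ℕ) :=
  lam.filter fun a => ∀ b ∈ lam, ¬ a < b

/-- Number of `(n-1)`-dimensional partitions of size `d`. -/
def pNum (d n : ℕ) : ℕ :=
  Set.ncard {lam : Finset (Fin n → ℕ) | IsPartitionFn lam ∧ lam.card = d}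

/-- Number of `(k-1)`-dimensional partitions of size `d` and embedding dimension `k`. -/
def yNum (d k : ℕ) : ℕ :=
  Set.ncard {lam : Finset (Fin k → ℕ) | IsPartitionFn lam ∧ lam.card = d ∧ hsFn lam 1 = k}

/-- Number of `(k-1)`-dimensional partitions of size `1+k+e`, embedding dimension `k`,
and socle in degree `≥ 2`. -/
def cNum (e k : ℕ) : ℕ :=
  Set.ncard {lam : Finset (Fin k → ℕ) | IsPartitionFn lam ∧ lam.card = 1 + k + e ∧
    hsFn lam 1 = k ∧ ∀ a ∈ socleFn lam, 2 ≤ degFn a}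

end

theorem aux_count (e : ℕ) (he : 1 ≤ e) :
    Set.ncard {σ : Equiv.Perm (Fin (2*e)) | σ.cycleType = Multiset.replicate e 2}
      = Nat.doubleFactorial (2 * e - 1) := by
  have h := Equiv.Perm.card_of_cycleType (Fin (2*e)) (Multiset.replicate e 2)
  rw [Set.ncard_eq_toFinset_card']
  have h2 : (Multiset.replicate e 2).sum ≤ Fintype.card (Fin (2*e)) ∧
      ∀ a ∈ Multiset.replicate e 2, 2 ≤ a := by
    constructor
    · simp [mul_comm]
    · intro a ha
      rw [Multiset.eq_of_mem_replicate ha]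
  rw [if_pos h2] at h
  have h3 : (Multiset.replicate e 2).toFinset = {2} := by
    rw [← Multiset.nsmul_singleton, Multiset.toFinset_nsmul _ _ (by omega)]; simp
  simp only [h3, Multiset.sum_replicate, Multiset.prod_replicate, Finset.prod_singleton,
    Multiset.count_replicate_self, Fintype.card_fin, smul_eq_mul, mul_comm e 2, Nat.sub_self,
    Nat.factorial_zero, one_mul] at h
  have h4 : (2*e).factorial = Nat.doubleFactorial (2*e-1) * (2^e * e.factorial) := by
    obtain ⟨m, hm⟩ : ∃ m, 2 * e = m + 1 := ⟨2*e-1, by omega⟩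
    rw [← Nat.doubleFactorial_two_mul, hm, Nat.factorial_eq_mul_doubleFactorial]
    simp [mul_comm]
  rw [h4, Nat.mul_div_cancel _ (by positivity)] at h
  rw [← h]
  congr 1
  ext σ
  simp

theorem aux_cyc (e : ℕ) (σ : Equiv.Perm (Fin (2*e))) :
    σ.cycleType = Multiset.replicate e 2 ↔ (∀ i, σ (σ i) = i) ∧ ∀ i, σ i ≠ i := by
  have : Fact (Nat.Prime 2) := ⟨Nat.prime_two⟩
  have hp : σ ^ 2 = 1 ↔ ∀ i, σ (σ i) = i := by
    rw [Equiv.ext_iff]; simp [pow_two]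
  have hs := σ.sum_cycleType
  have hu : σ.support = univ ↔ ∀ i, σ i ≠ i := by
    rw [Finset.ext_iff]; simp
  rw [← hp, ← hu, Equiv.Perm.pow_prime_eq_one_iff]
  constructor
  · intro h
    refine ⟨fun c hc => ?_, ?_⟩
    · rw [h] at hc; exact Multiset.eq_of_mem_replicate hc
    · rw [h] at hs
      apply Finset.eq_univ_of_card
      rw [← hs]; simp [mul_comm]
  · rintro ⟨h1, h2⟩
    have := Multiset.eq_replicate_card.2 h1
    rw [this, h2] at hs
    simp at hs
    rw [this]
    congr 1
    omega

/-- Unit vector. -/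
def dl {n : ℕ} (i : Fin n) : Fin n → ℕ := fun j => if j = i then 1 else 0

theorem deg_add {n : ℕ} (x y : Fin n → ℕ) : degFn (x + y) = degFn x + degFn y := by
  simp [degFn, Finset.sum_add_distrib]

theorem deg_dl {n : ℕ} (i : Fin n) : degFn (dl i) = 1 := by
  simp [degFn, dl]

theorem deg_zero {n : ℕ} : degFn (0 : Fin n → ℕ) = 0 := by
  simp [degFn]

theorem deg_mono {n : ℕ} {x y : Fin n → ℕ} (h : x ≤ y) : degFn x ≤ degFn y :=
  Finset.sum_le_sum fun i _ => h i

theorem deg_eq {n : ℕ} {x y : Fin n → ℕ} (h : x ≤ y) (h2 : degFn x = degFn y) : x = y := by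
  funext i
  exact (Finset.sum_eq_sum_iff_of_le (fun i _ => h i)).1 h2 i (mem_univ i)

theorem deg0 {n : ℕ} {x : Fin n → ℕ} (h : degFn x = 0) : x = 0 :=
  (deg_eq (show (0 : Fin n → ℕ) ≤ x from fun i => Nat.zero_le _) (by rw [h, deg_zero])).symm

theorem dl_le {n : ℕ} {x : Fin n → ℕ} {i : Fin n} (h : x i ≠ 0) : dl i ≤ x := by
  intro j
  by_cases hj : j = i
  · subst hj; simp [dl]; omega
  · simp [dl, hj]

theorem deg1 {n : ℕ} {x : Fin n → ℕ} (h : degFn x = 1) : ∃ i, x = dl i := by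
  by_contra hc
  push Not at hc
  have : x = 0 := by
    funext i
    by_contra hi
    exact hc i (deg_eq (dl_le hi) (by rw [h, deg_dl])).symm
  rw [this, deg_zero] at h
  omega

theorem dl_inj {n : ℕ} : Function.Injective (dl : Fin n → Fin n → ℕ) := by
  intro i j h
  have := congrFun h i
  by_contra hc
  simp [dl, hc] at this

theorem pair_eq {n : ℕ} {i j k l : Fin n} (h : dl i + dl j = dl k + dl l) :
    (i = k ∧ j = l) ∨ (i = l ∧ j = k) := by
  have h1 := congrFun h i
  by_cases hk : i = k
  · subst hk
    exact Or.inl ⟨rfl, dl_inj (add_left_cancel h)⟩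
  · by_cases hl : i = l
    · subst hl
      rw [add_comm (dl k)] at h
      exact Or.inr ⟨rfl, dl_inj (add_left_cancel h)⟩
    · simp [dl, hk, hl] at h1

/-- Top part attached to a function. -/
noncomputable def topP {n : ℕ} (f : Fin n → Fin n) : Finset (Fin n → ℕ) :=
  univ.image fun i => dl i + dl (f i)

/-- The partition attached to a function. -/
noncomputable def lamOf {n : ℕ} (f : Fin n → Fin n) : Finset (Fin n → ℕ) :=
  ({0} ∪ univ.image dl) ∪ topP f

theorem mem_lamOf {n : ℕ} (f : Fin n → Fin n) (x : Fin n → ℕ) :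
    x ∈ lamOf f ↔ (x = 0 ∨ ∃ i, x = dl i) ∨ ∃ i, x = dl i + dl (f i) := by
  simp [lamOf, topP, eq_comm, or_assoc]

theorem deg_top {n : ℕ} {f : Fin n → Fin n} {x : Fin n → ℕ} (h : x ∈ topP f) :
    degFn x = 2 := by
  simp only [topP, mem_image, mem_univ, true_and] at h
  obtain ⟨i, rfl⟩ := h
  rw [deg_add, deg_dl, deg_dl]

theorem card_top {e : ℕ} (f : Fin (2*e) → Fin (2*e)) (h1 : ∀ i, f (f i) = i)
    (h2 : ∀ i, f i ≠ i) : (topP f).card = e := by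
  have h := Finset.card_eq_sum_card_image (fun i => dl i + dl (f i)) (univ : Finset (Fin (2*e)))
  have : ∀ b ∈ topP f, (univ.filter fun i => dl i + dl (f i) = b).card = 2 := by
    intro b hb
    simp only [topP, mem_image, mem_univ, true_and] at hb
    obtain ⟨i, rfl⟩ := hb
    have : (univ.filter fun k => dl k + dl (f k) = dl i + dl (f i)) = {i, f i} := by
      ext k
      simp only [mem_filter, mem_univ, true_and, mem_insert, mem_singleton]
      constructor
      · intro h
        rcases pair_eq h with h | h
        · exact Or.inl h.1
        · exact Or.inr h.1
      · rintro (rfl | rfl)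
        · rfl
        · rw [h1, add_comm]
    rw [this, Finset.card_pair (h2 i).symm]
  have h' := h.trans (Finset.sum_congr rfl this)
  simp at h'
  unfold topP
  omega

theorem card_lamOf {e : ℕ} (f : Fin (2*e) → Fin (2*e)) (h1 : ∀ i, f (f i) = i)
    (h2 : ∀ i, f i ≠ i) : (lamOf f).card = 1 + 2 * e + e := by
  unfold lamOf
  rw [card_union_of_disjoint, card_union_of_disjoint, card_top f h1 h2,
    card_image_of_injective _ dl_inj]
  · simp
  · rw [Finset.disjoint_left]
    intro a ha hb
    simp only [mem_singleton, mem_image, mem_univ, true_and] at ha hb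
    obtain ⟨i, rfl⟩ := hb
    have := deg_dl i
    rw [ha, deg_zero] at this
    omega
  · rw [Finset.disjoint_left]
    intro a ha hb
    have hb := deg_top hb
    simp only [mem_union, mem_singleton, mem_image, mem_univ, true_and] at ha
    rcases ha with rfl | ⟨i, rfl⟩
    · rw [deg_zero] at hb; omega
    · rw [deg_dl] at hb; omega

theorem hs_one {n : ℕ} (lam : Finset (Fin n → ℕ)) : hsFn lam 1 = n ↔ ∀ i, dl i ∈ lam := by
  have hc : (univ.image (dl : Fin n → Fin n → ℕ)).card = n := by
    rw [card_image_of_injective _ dl_inj]; simp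
  have hsub : (lam.filter fun a => degFn a = 1) ⊆ univ.image (dl : Fin n → Fin n → ℕ) := by
    intro a ha
    obtain ⟨i, rfl⟩ := deg1 (mem_filter.1 ha).2
    simp
  constructor
  · intro h i
    have := Finset.eq_of_subset_of_card_le hsub (by rw [hc]; exact h.ge)
    have hi : dl i ∈ univ.image (dl : Fin n → Fin n → ℕ) := by simp
    rw [← this] at hi
    exact (mem_filter.1 hi).1
  · intro h
    have : (lam.filter fun a => degFn a = 1) = univ.image (dl : Fin n → Fin n → ℕ) := by
      apply subset_antisymm hsub
      intro a ha
      simp only [mem_image, mem_univ, true_and] at ha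
      obtain ⟨i, rfl⟩ := ha
      exact mem_filter.2 ⟨h i, deg_dl i⟩
    unfold hsFn
    rw [this, hc]

theorem lam_good {e : ℕ} (he : 1 ≤ e) (f : Fin (2*e) → Fin (2*e)) (h1 : ∀ i, f (f i) = i)
    (h2 : ∀ i, f i ≠ i) : IsPartitionFn (lamOf f) ∧ (lamOf f).card = 1 + 2 * e + e ∧
    hsFn (lamOf f) 1 = 2 * e ∧ ∀ a ∈ socleFn (lamOf f), 2 ≤ degFn a := by
  refine ⟨?_, card_lamOf f h1 h2, ?_, ?_⟩
  · intro a ha y hy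
    have hd := deg_mono hy
    have ha2 : degFn a ≤ 2 := by
      rw [mem_lamOf] at ha
      rcases ha with (rfl | ⟨i, rfl⟩) | ⟨i, rfl⟩ <;> simp [deg_zero, deg_add, deg_dl]
    by_cases heq : degFn y = degFn a
    · rw [deg_eq hy heq]; exact ha
    · rw [mem_lamOf]
      left
      by_cases h0 : degFn y = 0
      · exact Or.inl (deg0 h0)
      · exact Or.inr (deg1 (by omega))
  · rw [hs_one]
    intro i
    rw [mem_lamOf]
    exact Or.inl (Or.inr ⟨i, rfl⟩)
  · intro a ha
    obtain ⟨ha, hm⟩ := mem_filter.1 ha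
    by_contra hlt
    have key : ∀ b ∈ lamOf f, a ≤ b → 2 ≤ degFn b → False := by
      intro b hb hab h
      refine hm b hb (lt_of_le_of_ne hab ?_)
      rintro rfl
      exact hlt h
    have hmem : ∀ i, dl i + dl (f i) ∈ lamOf f := fun i => (mem_lamOf _ _).2 (Or.inr ⟨i, rfl⟩)
    have hdeg : ∀ i, 2 ≤ degFn (dl i + dl (f i)) := fun i => by simp [deg_add, deg_dl]
    by_cases h0 : degFn a = 0
    · rw [deg0 h0] at key
      exact key _ (hmem ⟨0, by omega⟩) (fun i => Nat.zero_le _) (hdeg _)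
    · obtain ⟨i, rfl⟩ := deg1 (show degFn a = 1 by omega)
      exact key _ (hmem i) (fun j => Nat.le_add_right _ _) (hdeg i)

theorem lam_inj {n : ℕ} (f g : Fin n → Fin n) (hg : ∀ i, g (g i) = i)
    (h : lamOf f = lamOf g) : f = g := by
  funext i
  have hi : dl i + dl (f i) ∈ lamOf g := by
    rw [← h]; exact (mem_lamOf _ _).2 (Or.inr ⟨i, rfl⟩)
  rw [mem_lamOf] at hi
  have hd : degFn (dl i + dl (f i)) = 2 := by simp [deg_add, deg_dl]
  rcases hi with (hi | ⟨k, hi⟩) | ⟨k, hi⟩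
  · rw [hi, deg_zero] at hd; omega
  · rw [hi, deg_dl] at hd; omega
  · rcases pair_eq hi with ⟨rfl, h⟩ | ⟨h, h'⟩
    · exact h
    · rw [h', h, hg]

theorem lam_surj {e : ℕ} (lam : Finset (Fin (2*e) → ℕ)) (hp : IsPartitionFn lam)
    (hc : lam.card = 1 + 2 * e + e) (hh : hsFn lam 1 = 2 * e)
    (hs : ∀ a ∈ socleFn lam, 2 ≤ degFn a) :
    ∃ f : Fin (2*e) → Fin (2*e), (∀ i, f (f i) = i) ∧ (∀ i, f i ≠ i) ∧ lamOf f = lam := by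
  have hu := (hs_one lam).1 hh
  have hf : ∀ i, ∃ j, dl i + dl j ∈ lam := by
    intro i
    by_contra hcon
    push Not at hcon
    have : dl i ∈ socleFn lam := by
      refine mem_filter.2 ⟨hu i, ?_⟩
      intro b hb hlt
      obtain ⟨hle, j, hj⟩ := Pi.lt_def.1 hlt
      apply hcon j
      apply hp b hb
      intro k
      have hk : dl i k ≤ b k := hle k
      by_cases hkj : k = j
      · subst hkj
        show dl i k + dl k k ≤ b k
        have : dl k k = 1 := by simp [dl]
        omega
      · have : dl j k = 0 := by simp [dl, hkj]
        show dl i k + dl j k ≤ b k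
        omega
    have := hs _ this
    rw [deg_dl] at this
    omega
  choose f hf using hf
  -- the top part of lam
  have hne : lam.Nonempty := by rw [← card_pos]; omega
  obtain ⟨a0, ha0⟩ := hne
  have h0 : (0 : Fin (2*e) → ℕ) ∈ lam := hp a0 ha0 0 (fun i => Nat.zero_le _)
  set B : Finset (Fin (2*e) → ℕ) := {0} ∪ univ.image dl with hB
  have hBc : B.card = 1 + 2 * e := by
    rw [hB, card_union_of_disjoint, card_image_of_injective _ dl_inj]
    · simp
    · rw [Finset.disjoint_left]
      intro a ha hb
      simp only [mem_singleton, mem_image, mem_univ, true_and] at ha hb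
      obtain ⟨i, rfl⟩ := hb
      have := deg_dl i
      rw [ha, deg_zero] at this
      omega
  have hBs : B ⊆ lam := by
    intro a ha
    simp only [hB, mem_union, mem_singleton, mem_image, mem_univ, true_and] at ha
    rcases ha with rfl | ⟨i, rfl⟩
    · exact h0
    · exact hu i
  have hBd : ∀ a ∈ B, degFn a ≤ 1 := by
    intro a ha
    simp only [hB, mem_union, mem_singleton, mem_image, mem_univ, true_and] at ha
    rcases ha with rfl | ⟨i, rfl⟩
    · simp [deg_zero]
    · simp [deg_dl]
  have hDc : (lam \ B).card = e := by
    rw [card_sdiff_of_subset hBs]; omega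
  have hmap : ∀ i ∈ (univ : Finset (Fin (2*e))), dl i + dl (f i) ∈ lam \ B := by
    intro i _
    refine mem_sdiff.2 ⟨hf i, fun h => ?_⟩
    have := hBd _ h
    simp [deg_add, deg_dl] at this
  have hsum := Finset.card_eq_sum_card_fiberwise hmap
  have hfib : ∀ i, (univ.filter fun k => dl k + dl (f k) = dl i + dl (f i)) ⊆ {i, f i} := by
    intro i k hk
    simp only [mem_filter, mem_univ, true_and] at hk
    simp only [mem_insert, mem_singleton]
    rcases pair_eq hk with h | h
    · exact Or.inl h.1
    · exact Or.inr h.1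
  have hle : ∀ b ∈ lam \ B, (univ.filter fun k => dl k + dl (f k) = b).card ≤ 2 := by
    intro b _
    by_cases hb : ∃ i, dl i + dl (f i) = b
    · obtain ⟨i, rfl⟩ := hb
      exact (card_le_card (hfib i)).trans card_le_two
    · have : (univ.filter fun k => dl k + dl (f k) = b) = ∅ := by
        apply filter_eq_empty_iff.2
        intro k _ hk
        exact hb ⟨k, hk⟩
      rw [this]; simp
  have heq : ∀ b ∈ lam \ B, (univ.filter fun k => dl k + dl (f k) = b).card = 2 := by
    apply (Finset.sum_eq_sum_iff_of_le hle).1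
    rw [← hsum]
    simp [hDc, mul_comm]
  have hfib2 : ∀ i, (univ.filter fun k => dl k + dl (f k) = dl i + dl (f i)) = {i, f i} := by
    intro i
    apply Finset.eq_of_subset_of_card_le (hfib i)
    rw [heq _ (hmap i (mem_univ i))]
    exact card_le_two
  have hnf : ∀ i, f i ≠ i := by
    intro i h
    have h2 := heq _ (hmap i (mem_univ i))
    rw [hfib2 i, h] at h2
    simp at h2
  refine ⟨f, ?_, hnf, ?_⟩
  · intro i
    have : f i ∈ (univ.filter fun k => dl k + dl (f k) = dl i + dl (f i)) := by
      rw [hfib2]; simp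
    rcases pair_eq (mem_filter.1 this).2 with h | h
    · exact absurd h.1 (hnf i)
    · exact h.2
  · have : topP f = lam \ B := by
      ext b
      simp only [topP, mem_image, mem_univ, true_and]
      constructor
      · rintro ⟨i, rfl⟩
        exact hmap i (mem_univ i)
      · intro hb
        have h2 := heq b hb
        have : (univ.filter fun k => dl k + dl (f k) = b).Nonempty := by
          rw [← card_pos]; omega
        obtain ⟨k, hk⟩ := this
        exact ⟨k, (mem_filter.1 hk).2⟩
    unfold lamOf
    rw [this]
    exact Finset.union_sdiff_of_subset hBs

/-- Proposition `rem:limitcases`(4): for `e ≥ 1`, `c_e^{2e} = (2e−1)!!`. -/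
theorem stmt7 (e : ℕ) (he : 1 ≤ e) :
    cNum e (2 * e) = Nat.doubleFactorial (2 * e - 1) := by
  rw [← aux_count e he]
  symm
  unfold cNum
  refine Set.ncard_congr (fun σ _ => lamOf σ) ?_ ?_ ?_
  · intro σ hσ
    obtain ⟨h1, h2⟩ := (aux_cyc e σ).1 hσ
    exact lam_good he σ h1 h2
  · intro σ τ _ hτ h
    exact DFunLike.coe_injective (lam_inj _ _ ((aux_cyc e τ).1 hτ).1 h)
  · rintro lam ⟨hp, hc, hh, hs⟩
    obtain ⟨f, h1, h2, h3⟩ := lam_surj lam hp hc hh hs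
    exact ⟨Function.Involutive.toPerm f h1, (aux_cyc e _).2 ⟨h1, h2⟩, h3⟩
end

section
/- Fix an integer n ≥ 1. Every (3n−1)-dimensional partition λ ⊆ ℕ^{3n} with embedding dimension h_λ(1) = 3n whose socle consists of exactly n elements, all of degree 3, has Hilbert–Samuel function (1, 3n, 3n, n): h_λ(0) = 1, h_λ(1) = h_λ(2) = 3n, h_λ(3) = n, and h_λ(i) = 0 for i > 3. Moreover, the number of such partitions equals (3n)!/(6^n·n!). -/
open Finset

attribute [local instance] Classical.propDecidable

/-- Partitions of `S` in blocks of size three. -/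
noncomputable def triP {m : ℕ} (S : Finset (Fin m)) : Finset (Finset (Finset (Fin m))) :=
  Finset.univ.filter fun P => (∀ B ∈ P, B ⊆ S ∧ B.card = 3) ∧ (∀ x ∈ S, ∃ B ∈ P, x ∈ B) ∧
    ∀ B ∈ P, ∀ C ∈ P, ∀ x, x ∈ B → x ∈ C → B = C

theorem mem_triP {m : ℕ} {S : Finset (Fin m)} {P : Finset (Finset (Fin m))} :
    P ∈ triP S ↔ (∀ B ∈ P, B ⊆ S ∧ B.card = 3) ∧ (∀ x ∈ S, ∃ B ∈ P, x ∈ B) ∧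
    ∀ B ∈ P, ∀ C ∈ P, ∀ x, x ∈ B → x ∈ C → B = C := by
  simp [triP]

theorem triP_rec {m : ℕ} (S : Finset (Fin m)) (x : Fin m) (hx : x ∈ S) :
    triP S = ((S.powersetCard 3).filter (fun B => x ∈ B)).biUnion
      fun B => (triP (S \ B)).image (insert B) := by
  ext P
  simp only [mem_biUnion, mem_filter, mem_powersetCard, mem_image, mem_triP]
  constructor
  · rintro ⟨h1, h2, h3⟩
    obtain ⟨B, hB, hxB⟩ := h2 x hx
    refine ⟨B, ⟨h1 B hB, hxB⟩, P.erase B, ⟨?_, ?_, ?_⟩, insert_erase hB⟩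
    · intro C hC
      rw [mem_erase] at hC
      refine ⟨fun y hy => ?_, (h1 C hC.2).2⟩
      rw [mem_sdiff]
      exact ⟨(h1 C hC.2).1 hy, fun h => hC.1 (h3 C hC.2 B hB y hy h)⟩
    · intro y hy
      rw [mem_sdiff] at hy
      obtain ⟨C, hC, hyC⟩ := h2 y hy.1
      refine ⟨C, mem_erase.2 ⟨?_, hC⟩, hyC⟩
      rintro rfl
      exact hy.2 hyC
    · intro C hC D hD
      exact h3 C (mem_of_mem_erase hC) D (mem_of_mem_erase hD)
  · rintro ⟨B, ⟨hB, hxB⟩, Q, ⟨h1, h2, h3⟩, rfl⟩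
    refine ⟨?_, ?_, ?_⟩
    · intro C hC
      rcases mem_insert.1 hC with rfl | hC
      · exact hB
      · exact ⟨(h1 C hC).1.trans sdiff_subset, (h1 C hC).2⟩
    · intro y hy
      by_cases hyB : y ∈ B
      · exact ⟨B, mem_insert_self _ _, hyB⟩
      · obtain ⟨C, hC, h⟩ := h2 y (mem_sdiff.2 ⟨hy, hyB⟩)
        exact ⟨C, mem_insert_of_mem hC, h⟩
    · intro C hC D hD y hyC hyD
      rcases mem_insert.1 hC with hCB | hC <;> rcases mem_insert.1 hD with hDB | hD
      · rw [hCB, hDB]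
      · exact absurd (hCB ▸ hyC) (mem_sdiff.1 ((h1 D hD).1 hyD)).2
      · exact absurd (hDB ▸ hyD) (mem_sdiff.1 ((h1 C hC).1 hyC)).2
      · exact h3 C hC D hD y hyC hyD

theorem card_filter_mem {m : ℕ} (S : Finset (Fin m)) (x : Fin m) (hx : x ∈ S) (k : ℕ)
    (hk : S.card = k + 1) :
    ((S.powersetCard 3).filter (fun B => x ∈ B)).card = k.choose 2 := by
  have h := card_filter_add_card_filter_not (s := S.powersetCard 3) (fun B => x ∈ B)
  have h2 : (S.powersetCard 3).filter (fun B => ¬ x ∈ B) = (S.erase x).powersetCard 3 := by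
    ext B
    simp only [mem_filter, mem_powersetCard, subset_erase]
    tauto
  rw [h2, card_powersetCard, card_powersetCard, card_erase_of_mem hx, hk,
    Nat.add_sub_cancel, Nat.choose_succ_succ' k 2] at h
  simp only [Nat.reduceAdd] at h
  omega

theorem card_triP {m : ℕ} : ∀ (n : ℕ) (S : Finset (Fin m)), S.card = 3 * n →
    (triP S).card * (6 ^ n * n.factorial) = (3 * n).factorial := by
  intro n
  induction n with
  | zero =>
    intro S hS
    have : S = ∅ := by simpa using hS
    subst this
    have : triP (∅ : Finset (Fin m)) = {∅} := by
      ext P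
      rw [mem_triP, mem_singleton]
      constructor
      · rintro ⟨h, -⟩
        rw [eq_empty_iff_forall_notMem]
        intro B hB
        obtain ⟨h1, h2⟩ := h B hB
        rw [subset_empty] at h1
        subst h1
        simp at h2
      · rintro rfl
        simp
    simp [this]
  | succ n ih =>
    intro S hS
    obtain ⟨x, hx⟩ : S.Nonempty := by rw [← card_pos]; omega
    have key : (triP S).card * (6 ^ n * n.factorial) =
        (3 * n + 2).choose 2 * (3 * n).factorial := by
      rw [triP_rec S x hx, card_biUnion, sum_mul]
      · rw [← card_filter_mem S x hx (3 * n + 2) (by omega), ← sum_const_nat (fun _ _ => rfl)]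
        refine sum_congr rfl fun B hB => ?_
        simp only [mem_filter, mem_powersetCard] at hB
        rw [card_image_of_injOn, ih]
        · rw [card_sdiff_of_subset hB.1.1]; omega
        · have hn : ∀ Q ∈ triP (S \ B), B ∉ Q := by
            intro Q hQ hBQ
            exact (mem_sdiff.1 (((mem_triP.1 hQ).1 B hBQ).1 hB.2)).2 hB.2
          intro Q hQ R hR hQR
          rw [← erase_insert (hn Q hQ), ← erase_insert (hn R hR)]
          rw [hQR]
      · intro B hB C hC hBC
        simp only [coe_filter, Set.mem_ofPred_eq, mem_powersetCard] at hB hC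
        rw [Function.onFun, disjoint_left]
        intro P hPB hPC
        simp only [mem_image] at hPB hPC
        obtain ⟨Q, hQ, rfl⟩ := hPB
        obtain ⟨R, hR, hRQ⟩ := hPC
        have : C ∈ insert B Q := by rw [← hRQ]; exact mem_insert_self _ _
        rcases mem_insert.1 this with h | h
        · exact hBC h.symm
        · exact (mem_sdiff.1 (((mem_triP.1 hQ).1 C h).1 hC.2)).2 hB.2
    have h2 : (3 * n + 2).choose 2 * 2 = (3 * n + 2) * (3 * n + 1) := by
      rw [Nat.choose_two_right]
      apply Nat.div_mul_cancel
      have := Nat.even_mul_pred_self (3 * n + 2)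
      exact this.two_dvd
    have e : 3 * (n + 1) = 3 * n + 1 + 1 + 1 := by ring
    rw [e, Nat.factorial_succ, Nat.factorial_succ, Nat.factorial_succ, pow_succ,
      Nat.factorial_succ]
    calc _ = ((triP S).card * (6 ^ n * n.factorial)) * (6 * (n + 1)) := by ring
      _ = ((3 * n + 2).choose 2 * 2) * (3 * n).factorial * (3 * (n + 1)) := by rw [key]; ring
      _ = _ := by rw [h2]; ring

/-- Indicator vector. -/
noncomputable def indv {m : ℕ} (B : Finset (Fin m)) : Fin m → ℕ := fun i => if i ∈ B then 1 else 0

/-- Support. -/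
noncomputable def supv {m : ℕ} (y : Fin m → ℕ) : Finset (Fin m) := univ.filter fun i => y i ≠ 0

theorem supv_indv {m : ℕ} (B : Finset (Fin m)) : supv (indv B) = B := by
  ext i; simp [supv, indv]

theorem indv_inj {m : ℕ} : Function.Injective (indv (m := m)) :=
  Function.LeftInverse.injective supv_indv

theorem indv_le {m : ℕ} {A B : Finset (Fin m)} : indv A ≤ indv B ↔ A ⊆ B := by
  constructor
  · intro h i hi
    have := h i
    by_contra hb
    simp [indv, hi, hb] at this
  · intro h i
    by_cases hi : i ∈ A
    · simp [indv, hi, h hi]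
    · simp [indv, hi]

theorem indv_supv {m : ℕ} {y : Fin m → ℕ} (h : ∀ i, y i ≤ 1) : indv (supv y) = y := by
  funext i
  have := h i
  by_cases hi : y i = 0
  · simp [indv, supv, hi]
  · simp [indv, supv, hi]; omega

theorem le_indv {m : ℕ} {y : Fin m → ℕ} {B : Finset (Fin m)} (h : y ≤ indv B) :
    ∃ A ⊆ B, indv A = y := by
  have h1 : indv (supv y) = y := indv_supv fun i => (h i).trans (by unfold indv; split_ifs <;> simp)
  exact ⟨supv y, by rwa [← indv_le, h1], h1⟩

theorem degFn_indv {m : ℕ} (B : Finset (Fin m)) : degFn (indv B) = B.card := by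
  simp [degFn, indv]

/-- The down-set generated by blocks. -/
noncomputable def dnF {m : ℕ} (P : Finset (Finset (Fin m))) : Finset (Fin m → ℕ) :=
  (P.biUnion powerset).image indv

theorem mem_dnF {m : ℕ} {P : Finset (Finset (Fin m))} {y : Fin m → ℕ} :
    y ∈ dnF P ↔ ∃ B ∈ P, y ≤ indv B := by
  simp only [dnF, mem_image, mem_biUnion, mem_powerset]
  constructor
  · rintro ⟨A, ⟨B, hB, hAB⟩, rfl⟩
    exact ⟨B, hB, indv_le.2 hAB⟩
  · rintro ⟨B, hB, h⟩
    obtain ⟨A, hA, rfl⟩ := le_indv h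
    exact ⟨A, ⟨B, hB, hA⟩, rfl⟩

theorem dnF_part {m : ℕ} (P : Finset (Finset (Fin m))) : IsPartitionFn (dnF P) := by
  intro a ha y hy
  rw [mem_dnF] at ha ⊢
  obtain ⟨B, hB, h⟩ := ha
  exact ⟨B, hB, hy.trans h⟩

theorem socle_dnF {m : ℕ} {S : Finset (Fin m)} {P : Finset (Finset (Fin m))} (hP : P ∈ triP S) :
    socleFn (dnF P) = P.image indv := by
  rw [mem_triP] at hP
  obtain ⟨h1, h2, h3⟩ := hP
  ext y
  simp only [socleFn, mem_filter, mem_image]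
  constructor
  · rintro ⟨hy, hm⟩
    obtain ⟨B, hB, h⟩ := mem_dnF.1 hy
    refine ⟨B, hB, ?_⟩
    by_contra hne
    exact hm (indv B) (mem_dnF.2 ⟨B, hB, le_rfl⟩) (lt_of_le_of_ne h (Ne.symm hne))
  · rintro ⟨B, hB, rfl⟩
    refine ⟨mem_dnF.2 ⟨B, hB, le_rfl⟩, ?_⟩
    intro b hb hlt
    obtain ⟨C, hC, h⟩ := mem_dnF.1 hb
    have hBC := indv_le.1 (hlt.le.trans h)
    obtain ⟨x, hx⟩ : B.Nonempty := by rw [← card_pos, (h1 B hB).2]; norm_num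
    have := h3 B hB C hC x hx (hBC hx)
    subst this
    exact absurd h (not_le_of_gt hlt)

theorem card_of_mem_triP {m n : ℕ} {S : Finset (Fin m)} {P : Finset (Finset (Fin m))}
    (hP : P ∈ triP S) (hS : S.card = 3 * n) : P.card = n := by
  rw [mem_triP] at hP
  obtain ⟨h1, h2, h3⟩ := hP
  have : S = P.biUnion id := by
    ext x
    simp only [mem_biUnion, id]
    exact ⟨h2 x, fun ⟨B, hB, hx⟩ => (h1 B hB).1 hx⟩
  rw [this, card_biUnion, sum_congr rfl (fun B hB => (show (id B).card = 3 from (h1 B hB).2))] at hS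
  · simp at hS; omega
  · intro B hB C hC hne
    rw [Function.onFun, disjoint_left]
    exact fun x hx hx' => hne (h3 B hB C hC x hx hx')

theorem hs_dnF {m n : ℕ} {S : Finset (Fin m)} {P : Finset (Finset (Fin m))}
    (hP : P ∈ triP S) (hS : S.card = 3 * n) (k : ℕ) (hk : 0 < k) :
    hsFn (dnF P) k = n * Nat.choose 3 k := by
  have hc := card_of_mem_triP hP hS
  rw [mem_triP] at hP
  obtain ⟨h1, h2, h3⟩ := hP
  have : (dnF P).filter (fun a => degFn a = k) =
      (P.biUnion fun B => B.powersetCard k).image indv := by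
    ext y
    simp only [dnF, mem_filter, mem_image, mem_biUnion, mem_powerset, mem_powersetCard]
    constructor
    · rintro ⟨⟨A, ⟨B, hB, hA⟩, rfl⟩, h⟩
      exact ⟨A, ⟨B, hB, hA, by rwa [degFn_indv] at h⟩, rfl⟩
    · rintro ⟨A, ⟨B, hB, hA, h⟩, rfl⟩
      exact ⟨⟨A, ⟨B, hB, hA⟩, rfl⟩, by rwa [degFn_indv]⟩
  rw [hsFn, this, card_image_of_injective _ indv_inj, card_biUnion,
    sum_congr rfl (fun B hB => by rw [card_powersetCard, (h1 B hB).2])]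
  · simp [hc]
  · intro B hB C hC hne
    rw [Function.onFun, disjoint_left]
    intro A hA hA'
    rw [mem_powersetCard] at hA hA'
    obtain ⟨x, hx⟩ : A.Nonempty := by rw [← card_pos, hA.2]; exact hk
    exact hne (h3 B hB C hC x (hA.1 hx) (hA'.1 hx))

theorem hs_zero {m n : ℕ} {P : Finset (Finset (Fin m))} (hP : P.card = n) (hn : 1 ≤ n) :
    hsFn (dnF P) 0 = 1 := by
  rw [hsFn, card_eq_one]
  refine ⟨0, ?_⟩
  ext y
  simp only [mem_filter, mem_singleton, mem_dnF]
  constructor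
  · rintro ⟨-, h⟩
    funext i
    simp only [degFn, sum_eq_zero_iff] at h
    exact h i (mem_univ i)
  · rintro rfl
    obtain ⟨B, hB⟩ : P.Nonempty := by rw [← card_pos]; omega
    exact ⟨⟨B, hB, fun i => Nat.zero_le _⟩, by simp [degFn]⟩

theorem single_mem {m : ℕ} {lam : Finset (Fin m → ℕ)} (h : hsFn lam 1 = m) (i : Fin m) :
    indv {i} ∈ lam := by
  have hsub : lam.filter (fun a => degFn a = 1) ⊆ univ.image fun i : Fin m => indv {i} := by
    intro y hy
    rw [mem_filter] at hy
    have hd := hy.2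
    have hle : ∀ j, y j ≤ 1 := fun j => by
      rw [← hd]; exact single_le_sum (f := y) (fun _ _ => Nat.zero_le _) (mem_univ j)
    have h1 := indv_supv hle
    rw [← h1, degFn_indv, card_eq_one] at hd
    obtain ⟨j, hj⟩ := hd
    rw [mem_image]
    exact ⟨j, mem_univ _, by rw [← hj, h1]⟩
  have heq := eq_of_subset_of_card_le hsub (by
    refine card_image_le.trans ?_
    rw [card_univ, Fintype.card_fin]
    exact h.ge)
  have : indv {i} ∈ univ.image fun i : Fin m => indv {i} := mem_image_of_mem _ (mem_univ i)
  rw [← heq] at this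
  exact (mem_filter.1 this).1

theorem exists_triP {n : ℕ} {lam : Finset (Fin (3 * n) → ℕ)} (hl : IsPartitionFn lam)
    (h1 : hsFn lam 1 = 3 * n) (hs : (socleFn lam).card = n)
    (hd : ∀ a ∈ socleFn lam, degFn a = 3) :
    ∃ P ∈ triP (univ : Finset (Fin (3 * n))), dnF P = lam := by
  have hmax : ∀ y ∈ lam, ∃ a ∈ socleFn lam, y ≤ a := by
    intro y hy
    obtain ⟨a, hya, ha⟩ := lam.exists_le_maximal hy
    refine ⟨a, ?_, hya⟩
    rw [socleFn, mem_filter]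
    exact ⟨ha.prop, fun b hb hlt => ha.not_gt hb hlt⟩
  have hge : ∀ i : Fin (3 * n), 1 ≤ ∑ a ∈ socleFn lam, a i := by
    intro i
    obtain ⟨a, ha, hia⟩ := hmax _ (single_mem h1 i)
    have h := hia i
    simp only [indv, mem_singleton, if_true] at h
    exact h.trans (single_le_sum (f := fun a : Fin (3 * n) → ℕ => a i)
      (fun _ _ => Nat.zero_le _) ha)
  have htot : ∑ i : Fin (3 * n), ∑ a ∈ socleFn lam, a i = ∑ i : Fin (3 * n), 1 := by
    have hd' : ∀ a ∈ socleFn lam, ∑ i : Fin (3 * n), a i = 3 := hd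
    rw [sum_comm, sum_congr rfl hd']
    simp [hs]; ring
  have hone : ∀ i : Fin (3 * n), ∑ a ∈ socleFn lam, a i = 1 := by
    intro i
    exact (((sum_eq_sum_iff_of_le fun i _ => hge i).1 htot.symm) i (mem_univ i)).symm
  have hle : ∀ a ∈ socleFn lam, ∀ i, a i ≤ 1 := by
    intro a ha i
    rw [← hone i]
    exact single_le_sum (f := fun a : Fin (3 * n) → ℕ => a i) (fun _ _ => Nat.zero_le _) ha
  have hind : ∀ a ∈ socleFn lam, indv (supv a) = a := fun a ha => indv_supv (hle a ha)
  refine ⟨(socleFn lam).image supv, ?_, ?_⟩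
  · rw [mem_triP]
    refine ⟨?_, ?_, ?_⟩
    · intro B hB
      obtain ⟨a, ha, rfl⟩ := mem_image.1 hB
      refine ⟨subset_univ _, ?_⟩
      rw [← degFn_indv, hind a ha, hd a ha]
    · intro i _
      obtain ⟨a, ha, hia⟩ := hmax _ (single_mem h1 i)
      refine ⟨supv a, mem_image_of_mem _ ha, ?_⟩
      have h := hia i
      simp only [indv, mem_singleton, if_true] at h
      simp only [supv, mem_filter, mem_univ, true_and]
      omega
    · intro B hB C hC i hiB hiC
      obtain ⟨a, ha, rfl⟩ := mem_image.1 hB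
      obtain ⟨b, hb, rfl⟩ := mem_image.1 hC
      simp only [supv, mem_filter, mem_univ, true_and] at hiB hiC
      by_contra hne
      have hab : a ≠ b := fun h => hne (by rw [h])
      have h2 : ∑ c ∈ ({a, b} : Finset (Fin (3 * n) → ℕ)), c i ≤ ∑ c ∈ socleFn lam, c i := by
        apply sum_le_sum_of_subset
        intro c hc
        rw [mem_insert, mem_singleton] at hc
        rcases hc with rfl | rfl <;> assumption
      rw [sum_pair hab, hone] at h2
      omega
  · ext y
    rw [mem_dnF]
    constructor
    · rintro ⟨B, hB, hy⟩
      obtain ⟨a, ha, rfl⟩ := mem_image.1 hB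
      rw [hind a ha] at hy
      exact hl a (mem_filter.1 ha).1 y hy
    · intro hy
      obtain ⟨a, ha, hya⟩ := hmax y hy
      exact ⟨supv a, mem_image_of_mem _ ha, by rwa [hind a ha]⟩

/-- Proposition `prop:max1`: for `n ≥ 1`, every partition
`λ ⊆ ℕ^{3n}` with embedding dimension `3n` and socle consisting of exactly `n` elements,
all of degree 3, has Hilbert–Samuel function `(1, 3n, 3n, n)`; and the number of such
partitions is `(3n)!/(6^n n!)`. -/
theorem stmt12 (n : ℕ) (hn : 1 ≤ n) :
    (∀ lam : Finset (Fin (3 * n) → ℕ), IsPartitionFn lam → hsFn lam 1 = 3 * n →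
      (socleFn lam).card = n → (∀ a ∈ socleFn lam, degFn a = 3) →
      (hsFn lam 0 = 1 ∧ hsFn lam 1 = 3 * n ∧ hsFn lam 2 = 3 * n ∧ hsFn lam 3 = n ∧
        ∀ i, 3 < i → hsFn lam i = 0)) ∧
    Set.ncard {lam : Finset (Fin (3 * n) → ℕ) | IsPartitionFn lam ∧ hsFn lam 1 = 3 * n ∧
        (socleFn lam).card = n ∧ ∀ a ∈ socleFn lam, degFn a = 3} =
      (3 * n).factorial / (6 ^ n * n.factorial) := by
  have hcard : (univ : Finset (Fin (3 * n))).card = 3 * n := by simp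
  constructor
  · intro lam hl h1 hs hd
    obtain ⟨P, hP, rfl⟩ := exists_triP hl h1 hs hd
    refine ⟨hs_zero (card_of_mem_triP hP hcard) hn, h1, ?_, ?_, ?_⟩
    · rw [hs_dnF hP hcard 2 (by norm_num)]
      simp [Nat.choose]; ring
    · rw [hs_dnF hP hcard 3 (by norm_num)]
      simp
    · intro i hi
      rw [hs_dnF hP hcard i (by omega), Nat.choose_eq_zero_of_lt hi, mul_zero]
  · have hset : {lam : Finset (Fin (3 * n) → ℕ) | IsPartitionFn lam ∧ hsFn lam 1 = 3 * n ∧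
        (socleFn lam).card = n ∧ ∀ a ∈ socleFn lam, degFn a = 3} =
        (((triP (univ : Finset (Fin (3 * n)))).image dnF : Finset _) : Set _) := by
      ext lam
      simp only [Set.mem_ofPred_eq, mem_coe, mem_image]
      constructor
      · rintro ⟨hl, h1, hs, hd⟩
        exact exists_triP hl h1 hs hd
      · rintro ⟨P, hP, rfl⟩
        refine ⟨dnF_part P, ?_, ?_, ?_⟩
        · rw [hs_dnF hP hcard 1 (by norm_num)]
          simp; ring
        · rw [socle_dnF hP, card_image_of_injective _ indv_inj, card_of_mem_triP hP hcard]
        · intro a ha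
          rw [socle_dnF hP] at ha
          obtain ⟨B, hB, rfl⟩ := mem_image.1 ha
          rw [degFn_indv, ((mem_triP.1 hP).1 B hB).2]
    rw [hset, Set.ncard_coe_finset, card_image_of_injOn]
    · rw [← card_triP n univ hcard, Nat.mul_div_cancel]
      positivity
    · intro P hP Q hQ h
      apply image_injective indv_inj
      rw [← socle_dnF hP, ← socle_dnF hQ, h]
end

section
/- Fix an integer n ≥ 1. The number of partitions λ ⊆ ℕ^{3n−2} with embedding dimension h_λ(1) = 3n−2, whose socle consists of exactly n elements all of degree 3, and whose Hilbert–Samuel function is (1, 3n−2, 3n−2, n) (i.e. h_λ(0)=1, h_λ(1)=h_λ(2)=3n−2, h_λ(3)=n, h_λ(i)=0 for i>3), equals (3n−2)^2·(3n−3)!/(6^{n−1}·(n−1)!). -/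
open Finset

attribute [local instance] Classical.propDecidable

def wN (j : ℕ) : ℕ := if j = 1 then 1 else if j = 2 then 2 else if j = 3 then 1 else 0

def PN : ℕ → ℕ → ℕ
  | 0, m => if m = 0 then 1 else 0
  | _ + 1, 0 => 0
  | n + 1, m + 1 => ∑ t ∈ Finset.range 3, m.choose t * (wN (t + 1) * PN n (m - t))

theorem PN_succ (n m : ℕ) : PN (n + 1) (m + 1) =
    PN n m + m * (2 * PN n (m - 1)) + m.choose 2 * PN n (m - 2) := by
  rw [PN]
  have h1 : wN 1 = 1 := by simp [wN]
  have h2 : wN 2 = 2 := by simp [wN]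
  have h3 : wN 3 = 1 := by simp [wN]
  simp [Finset.sum_range_succ, h1, h2, h3]

theorem PN_zero (n : ℕ) : ∀ m, 3 * n < m → PN n m = 0 := by
  induction n with
  | zero => intro m hm; simp [PN]; omega
  | succ n ih =>
    intro m hm
    obtain ⟨m, rfl⟩ : ∃ k, m = k + 1 := ⟨m - 1, by omega⟩
    rw [PN_succ, ih m (by omega), ih (m - 1) (by omega), ih (m - 2) (by omega)]; simp

theorem ch2 (a : ℕ) : 2 * (a + 1).choose 2 = (a + 1) * a := by
  rw [Nat.choose_two_right, Nat.add_sub_cancel, mul_comm a.succ]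
  exact Nat.mul_div_cancel' (by rw [mul_comm]; simpa [mul_comm] using (Nat.even_mul_succ_self a).two_dvd)

theorem PN_g (n : ℕ) : PN (n + 1) (3 * n + 3) = (3 * n + 2).choose 2 * PN n (3 * n) := by
  rw [PN_succ, PN_zero n (3*n+2) (by omega), PN_zero n (3*n+2-1) (by omega)]; simp

theorem PN_h (n : ℕ) : PN (n + 1) (3 * n + 2) = (3 * n + 2) * (3 * n + 1) * PN n (3 * n) := by
  induction n with
  | zero => simp [PN, wN, Finset.sum_range_succ]
  | succ n ih =>
    rw [show 3 * (n + 1) + 2 = (3 * n + 4) + 1 by ring, PN_succ, PN_zero _ (3 * n + 4) (by omega)]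
    simp only [show 3 * n + 4 - 1 = 3 * n + 3 by omega, show 3 * n + 4 - 2 = 3 * n + 2 by omega, ih,
      show 3 * (n + 1) = 3 * n + 3 by ring, PN_g]
    have h1 := ch2 (3 * n + 1)
    have h2 := ch2 (3 * n + 3)
    simp only [add_assoc, Nat.reduceAdd] at h1 h2
    have : (2 : ℤ) ≠ 0 := by norm_num
    zify at *
    apply mul_left_cancel₀ this
    linear_combination ((3 * n + 2) * (3 * n + 1) * (PN n (3 * n) : ℤ)) * h2 +
      (2 * (3 * n + 4) - (3 * n + 5) * (3 * n + 4) : ℤ) * (PN n (3 * n) : ℤ) * h1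

theorem PN_f (n : ℕ) : PN (n + 1) (3 * n + 1) = (3 * n + 1) ^ 2 * PN n (3 * n) := by
  induction n with
  | zero => simp [PN, wN, Finset.sum_range_succ]
  | succ n ih =>
    rw [show 3 * (n + 1) + 1 = (3 * n + 3) + 1 by ring, PN_succ]
    simp only [show 3 * n + 3 - 1 = 3 * n + 2 by omega, show 3 * n + 3 - 2 = 3 * n + 1 by omega, ih,
      show 3 * (n + 1) = 3 * n + 3 by ring, PN_g, PN_h]
    have h1 := ch2 (3 * n + 1)
    have h2 := ch2 (3 * n + 2)
    simp only [add_assoc, Nat.reduceAdd] at h1 h2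
    have : (2 : ℤ) ≠ 0 := by norm_num
    zify at *
    apply mul_left_cancel₀ this
    linear_combination ((3 * n + 1) ^ 2 * (PN n (3 * n) : ℤ)) * h2 +
      (1 - (3 * n + 4) ^ 2 : ℤ) * (PN n (3 * n) : ℤ) * h1

theorem PN_fac (n : ℕ) : PN n (3 * n) * (6 ^ n * n.factorial) = (3 * n).factorial := by
  induction n with
  | zero => simp [PN, wN, Finset.sum_range_succ]
  | succ n ih =>
    have h1 := ch2 (3 * n + 1)
    simp only [add_assoc, Nat.reduceAdd] at h1
    rw [show 3 * (n + 1) = 3 * n + 3 by ring, PN_g, Nat.factorial_succ, Nat.factorial_succ (3*n+2),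
      Nat.factorial_succ (3*n+1), Nat.factorial_succ (3*n), ← ih, pow_succ]
    zify at *
    linear_combination (3 * (n + 1) * PN n (3 * n) * 6 ^ n * n.factorial : ℤ) * h1

theorem PN_final (n : ℕ) : PN (n + 1) (3 * n + 1) =
    (3 * n + 1) ^ 2 * ((3 * n).factorial / (6 ^ n * n.factorial)) := by
  rw [PN_f, ← PN_fac, Nat.mul_div_cancel _ (by positivity)]

noncomputable def spF {k : ℕ} (c : Fin k → ℕ) : Finset (Fin k) := univ.filter (fun i => c i ≠ 0)

theorem mem_spF {k : ℕ} (c : Fin k → ℕ) (i : Fin k) : i ∈ spF c ↔ c i ≠ 0 := by simp [spF]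

theorem sum_spF {k : ℕ} (c : Fin k → ℕ) : ∑ i ∈ spF c, c i = degFn c := by
  unfold spF degFn
  rw [Finset.sum_filter_ne_zero]

theorem card_spF_le {k : ℕ} (c : Fin k → ℕ) : (spF c).card ≤ degFn c := by
  rw [← sum_spF, Finset.card_eq_sum_ones]
  apply Finset.sum_le_sum
  intro i hi
  rw [mem_spF] at hi
  omega

noncomputable def CubF (k : ℕ) : Finset (Fin k → ℕ) := Finset.piAntidiag univ 3

theorem mem_CubF {k : ℕ} (c : Fin k → ℕ) : c ∈ CubF k ↔ degFn c = 3 := by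
  simp [CubF, degFn]

theorem spF_nonempty {k : ℕ} (c : Fin k → ℕ) (h : degFn c ≠ 0) : (spF c).Nonempty := by
  by_contra h'
  rw [Finset.not_nonempty_iff_eq_empty] at h'
  rw [← sum_spF, h'] at h
  simp at h

theorem card_fib {k : ℕ} (S : Finset (Fin k)) :
    ((CubF k).filter (fun c => spF c = S)).card = wN S.card := by
  have key : ∀ c : Fin k → ℕ, c ∈ (CubF k).filter (fun c => spF c = S) ↔
      (∑ i ∈ S, c i = 3 ∧ (∀ i ∈ S, c i ≠ 0) ∧ ∀ i ∉ S, c i = 0) := by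
    intro c
    rw [mem_filter, mem_CubF]
    constructor
    · rintro ⟨h1, h2⟩
      rw [← h2, sum_spF]
      refine ⟨h1, fun i hi => (mem_spF _ _).1 hi, fun i hi => ?_⟩
      rw [mem_spF] at hi; simpa using hi
    · rintro ⟨h1, h2, h3⟩
      have : spF c = S := by
        ext i
        rw [mem_spF]
        constructor
        · intro h; by_contra h'; exact h (h3 i h')
        · exact h2 i
      rw [← sum_spF, this]
      exact ⟨h1, rfl⟩
  by_cases h1 : S.card = 1
  · obtain ⟨a, rfl⟩ := Finset.card_eq_one.1 h1
    simp only [h1, wN, if_true]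
    rw [Finset.card_eq_one]
    refine ⟨fun i => if i = a then 3 else 0, ?_⟩
    ext c
    rw [key]
    simp only [sum_singleton, mem_singleton]
    constructor
    · rintro ⟨h1, h2, h3⟩
      funext i
      by_cases hi : i = a
      · simp [hi, h1]
      · simp [hi, h3]
    · rintro rfl
      simp
      
  by_cases h2 : S.card = 2
  · obtain ⟨a, b, hab, rfl⟩ := Finset.card_eq_two.1 h2
    simp only [h2, wN, if_true]
    norm_num
    rw [Finset.card_eq_two]
    refine ⟨fun i => if i = a then 2 else if i = b then 1 else 0,
      fun i => if i = a then 1 else if i = b then 2 else 0, ?_, ?_⟩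
    · intro h
      have := congrFun h a
      simp at this
    ext c
    rw [key]
    simp only [sum_pair hab, mem_singleton, mem_insert]
    constructor
    · rintro ⟨h1, h2, h3⟩
      have ha := h2 a (Or.inl rfl)
      have hb := h2 b (Or.inr rfl)
      have : (c a = 2 ∧ c b = 1) ∨ (c a = 1 ∧ c b = 2) := by omega
      rcases this with ⟨h4, h5⟩ | ⟨h4, h5⟩
      · left
        funext i
        by_cases hi : i = a
        · simp [hi, h4]
        by_cases hj : i = b
        · simp [hj, h5, Ne.symm hab]
        simp [hi, hj, h3]
      · right
        funext i
        by_cases hi : i = a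
        · simp [hi, h4]
        by_cases hj : i = b
        · simp [hj, h5, Ne.symm hab]
        simp [hi, hj, h3]
    · rintro (rfl | rfl)
      · refine ⟨by simp [Ne.symm hab], ?_, ?_⟩
        · rintro i (rfl | rfl) <;> simp [Ne.symm hab]
        · intro i hi; push Not at hi; simp [hi]
      · refine ⟨by simp [Ne.symm hab], ?_, ?_⟩
        · rintro i (rfl | rfl) <;> simp [Ne.symm hab]
        · intro i hi; push Not at hi; simp [hi]
  by_cases h3 : S.card = 3
  · simp only [h3, wN]
    norm_num
    rw [Finset.card_eq_one]
    refine ⟨fun i => if i ∈ S then 1 else 0, ?_⟩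
    ext c
    rw [key]
    simp only [mem_singleton]
    constructor
    · rintro ⟨h1, h2, h4⟩
      have h5 : ∑ i ∈ S, 1 = ∑ i ∈ S, c i := by rw [h1, ← h3]; simp
      rw [Finset.sum_eq_sum_iff_of_le (fun i hi => by have := h2 i hi; omega)] at h5
      funext i
      by_cases hi : i ∈ S
      · simp [hi, ← h5 i hi]
      · simp [hi, h4 i hi]
    · rintro rfl
      refine ⟨?_, ?_, ?_⟩
      · simp [h3]
      · intro i hi; simp [hi]
      · intro i hi; simp [hi]
  · simp only [wN, h1, h2, h3, if_false]
    rw [Finset.card_eq_zero, Finset.eq_empty_iff_forall_notMem]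
    intro c hc
    have hc2 := mem_filter.1 hc
    rw [mem_CubF] at hc2
    have hle := card_spF_le c
    have hne := (spF_nonempty c (by omega)).card_pos
    rw [hc2.2] at hle hne
    omega

noncomputable def GF (k : ℕ) (V : Finset (Fin k)) (n : ℕ) : Finset (Finset (Fin k → ℕ)) :=
  ((CubF k).powersetCard n).filter (fun M =>
    (M : Set (Fin k → ℕ)).PairwiseDisjoint spF ∧ M.biUnion spF = V)

theorem mem_GF {k : ℕ} {V : Finset (Fin k)} {n : ℕ} {M : Finset (Fin k → ℕ)} :
    M ∈ GF k V n ↔ (∀ c ∈ M, degFn c = 3) ∧ M.card = n ∧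
      (M : Set (Fin k → ℕ)).PairwiseDisjoint spF ∧ M.biUnion spF = V := by
  simp only [GF, mem_filter, mem_powersetCard, Finset.subset_iff, mem_CubF]
  tauto

theorem GF_rec {k : ℕ} (V : Finset (Fin k)) (n : ℕ) (v : Fin k) (hv : v ∈ V) :
    (GF k V (n + 1)).card =
      ∑ c ∈ (CubF k).filter (fun c => v ∈ spF c ∧ spF c ⊆ V), (GF k (V \ spF c) n).card := by
  have hnot : ∀ c M, v ∈ spF c → M ∈ GF k (V \ spF c) n → ∀ d ∈ M, Disjoint (spF c) (spF d) := by
    intro c M hvc hM d hd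
    rw [mem_GF] at hM
    have : spF d ⊆ V \ spF c := by
      rw [← hM.2.2.2]; exact Finset.subset_biUnion_of_mem spF hd
    rw [Finset.disjoint_left]
    intro x hx hx2
    exact (mem_sdiff.1 (this hx2)).2 hx
  have hnm : ∀ c M, v ∈ spF c → M ∈ GF k (V \ spF c) n → c ∉ M := by
    intro c M hvc hM hc
    have := hnot c M hvc hM c hc
    rw [Finset.disjoint_left] at this
    exact this hvc hvc
  have heq : GF k V (n + 1) = ((CubF k).filter (fun c => v ∈ spF c ∧ spF c ⊆ V)).biUnion
      (fun c => (GF k (V \ spF c) n).image (fun M => insert c M)) := by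
    ext M
    simp only [mem_biUnion, mem_image, mem_filter, mem_CubF]
    constructor
    · intro hM
      rw [mem_GF] at hM
      obtain ⟨h1, h2, h3, h4⟩ := hM
      have hv' := hv
      rw [← h4, mem_biUnion] at hv'
      obtain ⟨c, hc, hvc⟩ := hv'
      refine ⟨c, ⟨h1 c hc, hvc, ?_⟩, M.erase c, ?_, Finset.insert_erase hc⟩
      · rw [← h4]; exact Finset.subset_biUnion_of_mem spF hc
      · rw [mem_GF]
        refine ⟨fun d hd => h1 d (Finset.mem_of_mem_erase hd), ?_, ?_, ?_⟩
        · rw [Finset.card_erase_of_mem hc, h2]; rfl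
        · exact h3.subset (by simp)
        · ext x
          simp only [mem_biUnion, mem_erase, mem_sdiff, ← h4]
          constructor
          · rintro ⟨d, ⟨hdc, hd⟩, hx⟩
            refine ⟨⟨d, hd, hx⟩, ?_⟩
            exact Finset.disjoint_left.1 (h3 hd hc hdc) hx
          · rintro ⟨⟨d, hd, hx⟩, hx2⟩
            refine ⟨d, ⟨?_, hd⟩, hx⟩
            rintro rfl; exact hx2 hx
    · rintro ⟨c, ⟨h1, h2, h3⟩, M', hM', rfl⟩
      have hd := hnot c M' h2 hM'
      have hn := hnm c M' h2 hM'
      rw [mem_GF] at hM' ⊢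
      obtain ⟨a1, a2, a3, a4⟩ := hM'
      refine ⟨?_, ?_, ?_, ?_⟩
      · intro d hd
        rcases mem_insert.1 hd with rfl | h
        · exact h1
        · exact a1 d h
      · rw [Finset.card_insert_of_notMem hn, a2]
      · rw [Finset.coe_insert]
        exact a3.insert (fun d hd' _ => hd d hd')
      · rw [Finset.biUnion_insert, a4]
        exact Finset.union_sdiff_of_subset h3
  rw [heq, Finset.card_biUnion]
  · apply Finset.sum_congr rfl
    intro c hc
    rw [mem_filter] at hc
    apply Finset.card_image_of_injOn
    intro M hM M' hM' h
    have e1 := Finset.erase_insert (hnm c M hc.2.1 hM)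
    have e2 := Finset.erase_insert (hnm c M' hc.2.1 hM')
    simp only at h
    rw [← e1, ← e2, h]
  · intro c hc c' hc' hcc
    rw [Function.onFun, Finset.disjoint_left]
    intro M hM hM'
    simp only [mem_image] at hM hM'
    obtain ⟨A, hA, rfl⟩ := hM
    obtain ⟨B, hB, h⟩ := hM'
    have hc2 := (mem_filter.1 hc).2.1
    have hc2' := (mem_filter.1 hc').2.1
    have : c ∈ insert c' B := by rw [h]; exact mem_insert_self _ _
    rcases mem_insert.1 this with h' | h'
    · exact hcc h'
    · exact Finset.disjoint_left.1 (hnot c' B hc2' hB c h') hc2' hc2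

theorem card_GF {k : ℕ} (n : ℕ) : ∀ V : Finset (Fin k), (GF k V n).card = PN n V.card := by
  induction n with
  | zero =>
    intro V
    by_cases hV : V = ∅
    · subst hV
      simp only [PN, card_empty, if_true]
      rw [Finset.card_eq_one]
      refine ⟨∅, ?_⟩
      ext M
      rw [mem_GF, mem_singleton]
      constructor
      · rintro ⟨_, h, _⟩; exact Finset.card_eq_zero.1 h
      · rintro rfl; simp
    · simp only [PN, Finset.card_eq_zero, hV, if_false]
      rw [Finset.eq_empty_iff_forall_notMem]
      intro M hM
      rw [mem_GF] at hM
      obtain ⟨_, h, _, h2⟩ := hM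
      rw [Finset.card_eq_zero.1 h] at h2
      exact hV (by rw [← h2]; simp)
  | succ n ih =>
    intro V
    rcases V.eq_empty_or_nonempty with rfl | ⟨v, hv⟩
    · simp only [PN, card_empty]
      rw [Finset.card_eq_zero, Finset.eq_empty_iff_forall_notMem]
      intro M hM
      rw [mem_GF] at hM
      obtain ⟨h1, h, _, h2⟩ := hM
      obtain ⟨c, hc⟩ : M.Nonempty := by rw [← Finset.card_pos]; omega
      obtain ⟨x, hx⟩ := spF_nonempty c (by rw [h1 c hc]; norm_num)
      have : x ∈ M.biUnion spF := mem_biUnion.2 ⟨c, hc, hx⟩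
      rw [h2] at this
      simp at this
    · rw [GF_rec V n v hv]
      have hcard : V.card = (V.erase v).card + 1 := (Finset.card_erase_add_one hv).symm
      set W := V.erase v with hW
      have hvW : v ∉ W := by simp [hW]
      have hVW : insert v W = V := Finset.insert_erase hv
      rw [hcard, PN]
      have hmaps : ∀ c ∈ (CubF k).filter (fun c => v ∈ spF c ∧ spF c ⊆ V),
          (spF c).erase v ∈ W.powerset := by
        intro c hc
        rw [mem_filter] at hc
        rw [mem_powerset]
        exact Finset.erase_subset_erase _ hc.2.2
      rw [← Finset.sum_fiberwise_of_maps_to hmaps]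
      have hin : ∀ T ∈ W.powerset, ∑ c ∈ ((CubF k).filter (fun c => v ∈ spF c ∧ spF c ⊆ V)).filter
          (fun c => (spF c).erase v = T), (GF k (V \ spF c) n).card =
          (fun t => wN (t + 1) * PN n (W.card - t)) T.card := by
        intro T hT
        rw [mem_powerset] at hT
        have hvT : v ∉ T := fun h => hvW (hT h)
        have : ((CubF k).filter (fun c => v ∈ spF c ∧ spF c ⊆ V)).filter
          (fun c => (spF c).erase v = T) = (CubF k).filter (fun c => spF c = insert v T) := by
          ext c
          simp only [mem_filter, and_assoc]
          apply and_congr_right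
          intro _
          constructor
          · rintro ⟨h1, _, rfl⟩
            exact (Finset.insert_erase h1).symm
          · intro h
            rw [h]
            refine ⟨mem_insert_self _ _, ?_, Finset.erase_insert hvT⟩
            rw [← hVW]; exact Finset.insert_subset_insert _ hT
        rw [this]
        have hc2 : (insert v T).card = T.card + 1 := Finset.card_insert_of_notMem hvT
        rw [Finset.sum_congr rfl (g := fun _ => PN n (W.card - T.card)), Finset.sum_const, card_fib,
          hc2, smul_eq_mul]
        intro c hc
        rw [ih, (mem_filter.1 hc).2, Finset.card_sdiff_of_subset, hc2, hcard]
        · congr 1; omega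
        · rw [← hVW]; exact Finset.insert_subset_insert _ hT
      rw [Finset.sum_congr rfl hin, Finset.sum_powerset_apply_card (fun t => wN (t + 1) * PN n (W.card - t))]
      simp only [smul_eq_mul]
      have e1 : Finset.range (W.card + 1) ⊆ Finset.range (W.card + 3) := by
        intro x; simp; omega
      have e2 : Finset.range 3 ⊆ Finset.range (W.card + 3) := by
        intro x; simp; omega
      rw [Finset.sum_subset e1, Finset.sum_subset e2]
      · intro x _ hx
        have : wN (x + 1) = 0 := by simp at hx; unfold wN; split_ifs <;> omega
        simp [this]
      · intro x _ hx
        have : W.card.choose x = 0 := Nat.choose_eq_zero_of_lt (by simp at hx; omega)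
        simp [this]

noncomputable def QdF {k : ℕ} (c : Fin k → ℕ) : Finset (Fin k → ℕ) :=
  (Finset.Iic c).filter (fun q => degFn q = 2)

theorem mem_QdF {k : ℕ} {c q : Fin k → ℕ} : q ∈ QdF c ↔ q ≤ c ∧ degFn q = 2 := by
  simp [QdF]

theorem degFn_add {k : ℕ} (a b : Fin k → ℕ) : degFn (a + b) = degFn a + degFn b := by
  simp [degFn, Finset.sum_add_distrib]

theorem degFn_mono {k : ℕ} {a b : Fin k → ℕ} (h : a ≤ b) : degFn a ≤ degFn b :=
  Finset.sum_le_sum (fun i _ => h i)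

theorem eq_of_degFn {k : ℕ} {a b : Fin k → ℕ} (h : a ≤ b) (hd : degFn b ≤ degFn a) : a = b := by
  have h1 : degFn a = degFn b := le_antisymm (degFn_mono h) hd
  unfold degFn at h1
  rw [Finset.sum_eq_sum_iff_of_le (fun i _ => h i)] at h1
  funext i
  exact h1 i (mem_univ i)

theorem degFn_sub {k : ℕ} {a b : Fin k → ℕ} (h : a ≤ b) : degFn (b - a) + degFn a = degFn b := by
  rw [← degFn_add, tsub_add_cancel_of_le h]

theorem degFn_single {k : ℕ} (i : Fin k) : degFn (Pi.single i 1 : Fin k → ℕ) = 1 := by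
  simp [degFn]

theorem single_le {k : ℕ} {c : Fin k → ℕ} {i : Fin k} :
    (Pi.single i 1 : Fin k → ℕ) ≤ c ↔ i ∈ spF c := by
  rw [mem_spF]
  constructor
  · intro h
    have := h i
    simp at this
    omega
  · intro h j
    by_cases hj : j = i
    · subst hj; simp; omega
    · simp [Pi.single_eq_of_ne hj]

theorem spF_mono {k : ℕ} {a b : Fin k → ℕ} (h : a ≤ b) : spF a ⊆ spF b := by
  intro i hi
  rw [mem_spF] at *
  have : a i ≤ b i := h i
  omega

theorem card_QdF {k : ℕ} (m : Fin k → ℕ) (hm : degFn m = 3) : (QdF m).card = (spF m).card := by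
  symm
  apply Finset.card_bij (fun i _ => m - Pi.single i 1)
  · intro i hi
    rw [mem_QdF]
    refine ⟨tsub_le_self, ?_⟩
    have := degFn_sub (single_le.2 hi)
    rw [degFn_single] at this
    omega
  · intro i hi j hj h
    by_contra hij
    have := congrFun h i
    rw [mem_spF] at hi
    simp [Pi.single_eq_of_ne hij] at this
    omega
  · intro q hq
    rw [mem_QdF] at hq
    have h1 := degFn_sub hq.1
    obtain ⟨i, hi⟩ := spF_nonempty (m - q) (by omega)
    have h2 := single_le.2 hi
    have h5 : i ∈ spF m := spF_mono tsub_le_self hi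
    have h3 := degFn_sub (single_le.2 h5)
    rw [degFn_single] at h3
    refine ⟨i, h5, ?_⟩
    symm
    apply eq_of_degFn
    · intro j
      have a := h2 j
      have b := hq.1 j
      simp only [Pi.sub_apply] at *
      omega
    · omega

theorem disj_of_card {α β : Type*} [DecidableEq α] [DecidableEq β] (s : Finset α) (f : α → Finset β)
    (h : ∑ a ∈ s, (f a).card ≤ (s.biUnion f).card) : (s : Set α).PairwiseDisjoint f := by
  intro a ha b hb hab
  rw [Function.onFun, Finset.disjoint_left]
  intro x hxa hxb
  have hs : s.biUnion f = (s.erase a).biUnion f ∪ (f a).erase x := by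
    ext y
    simp only [mem_biUnion, mem_union, mem_erase]
    constructor
    · rintro ⟨c, hc, hy⟩
      by_cases hca : c = a
      · subst hca
        by_cases hyx : y = x
        · subst hyx; exact Or.inl ⟨b, ⟨Ne.symm hab, hb⟩, hxb⟩
        · exact Or.inr ⟨hyx, hy⟩
      · exact Or.inl ⟨c, ⟨hca, hc⟩, hy⟩
    · rintro (⟨c, ⟨_, hc⟩, hy⟩ | ⟨_, hy⟩)
      · exact ⟨c, hc, hy⟩
      · exact ⟨a, ha, hy⟩
  have h1 := Finset.card_union_le ((s.erase a).biUnion f) ((f a).erase x)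
  have h2 : ((s.erase a).biUnion f).card ≤ _ := Finset.card_biUnion_le
  have h3 := Finset.add_sum_erase s (fun a => (f a).card) ha
  have h4 := Finset.card_erase_add_one hxa
  rw [hs] at h
  omega

theorem QdF_disj {k : ℕ} {a b : Fin k → ℕ} (h : Disjoint (spF a) (spF b)) :
    Disjoint (QdF a) (QdF b) := by
  rw [Finset.disjoint_left]
  intro q hq hq'
  rw [mem_QdF] at hq hq'
  obtain ⟨i, hi⟩ := spF_nonempty q (by omega)
  exact Finset.disjoint_left.1 h (spF_mono hq.1 hi) (spF_mono hq'.1 hi)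

theorem inter_QdF {k : ℕ} {a b : Fin k → ℕ} (ha : degFn a = 3) (hb : degFn b = 3) (hab : a ≠ b) :
    (QdF a ∩ QdF b).card ≤ 1 := by
  rw [Finset.card_le_one]
  intro p hp q hq
  by_contra hpq
  simp only [mem_inter, mem_QdF] at hp hq
  have hsup : degFn (p ⊔ q) ≥ 3 := by
    by_contra hlt
    have e1 : p = p ⊔ q := eq_of_degFn le_sup_left (by omega)
    have e2 : q = p ⊔ q := eq_of_degFn le_sup_right (by omega)
    exact hpq (e1.trans e2.symm)
  have e1 : p ⊔ q = a := eq_of_degFn (sup_le hp.1.1 hq.1.1) (by omega)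
  have e2 : p ⊔ q = b := eq_of_degFn (sup_le hp.2.1 hq.2.1) (by omega)
  exact hab (e1.symm.trans e2)

theorem key_disj {k n : ℕ} (M : Finset (Fin k → ℕ)) (h3 : ∀ c ∈ M, degFn c = 3)
    (hn : M.card = n) (hs : (M.biUnion spF).card + 2 = 3 * n)
    (hq : (M.biUnion QdF).card + 2 = 3 * n) : (M : Set (Fin k → ℕ)).PairwiseDisjoint spF := by
  by_cases hd : (M : Set (Fin k → ℕ)).PairwiseDisjoint QdF
  · apply disj_of_card
    rw [Finset.card_biUnion (fun a ha b hb hab => hd ha hb hab)] at hq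
    rw [Finset.sum_congr rfl (fun c hc => card_QdF c (h3 c hc))] at hq
    omega
  exfalso
  rw [Set.PairwiseDisjoint, Set.Pairwise] at hd
  push Not at hd
  obtain ⟨a, ha, b, hb, hab, hnd⟩ := hd
  rw [Function.onFun, Finset.not_disjoint_iff] at hnd
  obtain ⟨q, hqa, hqb⟩ := hnd
  have ha3 := h3 a ha
  have hb3 := h3 b hb
  have hint := inter_QdF ha3 hb3 hab
  rw [mem_QdF] at hqa hqb
  set R := (M.erase a).erase b with hR
  have hb' : b ∈ M.erase a := mem_erase.2 ⟨Ne.symm hab, hb⟩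
  have hMR : M = insert a (insert b R) := by
    rw [hR, Finset.insert_erase hb', Finset.insert_erase ha]
  have hRM : ∀ c ∈ R, c ∈ M := fun c hc => mem_of_mem_erase (mem_of_mem_erase hc)
  have hRc : R.card + 2 = n := by
    have e1 := Finset.card_erase_add_one hb'
    have e2 := Finset.card_erase_add_one ha
    rw [← hR] at e1
    omega
  have hS : M.biUnion spF = (spF a ∪ spF b) ∪ R.biUnion spF := by
    rw [hMR, Finset.biUnion_insert, Finset.biUnion_insert, Finset.union_assoc]
  have hQ : M.biUnion QdF = (QdF a ∪ QdF b) ∪ R.biUnion QdF := by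
    rw [hMR, Finset.biUnion_insert, Finset.biUnion_insert, Finset.union_assoc]
  have hsub : ∀ c : Fin k → ℕ, q ≤ c → (spF c).card ≤ (spF q).card + degFn (c - q) := by
    intro c hc
    have : spF c ⊆ spF q ∪ spF (c - q) := by
      intro i hi
      rw [mem_union, mem_spF, mem_spF]
      rw [mem_spF] at hi
      simp only [Pi.sub_apply]
      omega
    have h1 := Finset.card_le_card this
    have h2 := Finset.card_union_le (spF q) (spF (c - q))
    have h3 := card_spF_le (c - q)
    omega
  have hva := hsub a hqa.1
  have hvb := hsub b hqb.1
  have hda := degFn_sub hqa.1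
  have hdb := degFn_sub hqb.1
  have hsq := card_spF_le q
  have hui := Finset.card_union_add_card_inter (spF a) (spF b)
  have hle : (spF q).card ≤ (spF a ∩ spF b).card :=
    Finset.card_le_card (Finset.subset_inter (spF_mono hqa.1) (spF_mono hqb.1))
  have hB : (R.biUnion spF).card ≤ ∑ c ∈ R, (spF c).card := Finset.card_biUnion_le
  have hB2 : ∑ c ∈ R, (spF c).card ≤ R.card * 3 := by
    rw [← smul_eq_mul]
    apply Finset.sum_le_card_nsmul
    intro c hc
    have := card_spF_le c
    rw [h3 c (hRM c hc)] at this
    exact this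
  have hAB := Finset.card_union_add_card_inter (spF a ∪ spF b) (R.biUnion spF)
  rw [hS] at hs
  have hdis : (spF a ∪ spF b) ∩ R.biUnion spF = ∅ := by
    rw [← Finset.card_eq_zero]; omega
  rw [← Finset.disjoint_iff_inter_eq_empty, Finset.disjoint_union_left] at hdis
  have hRd : (R : Set (Fin k → ℕ)).PairwiseDisjoint spF := disj_of_card _ _ (by omega)
  have hRq : (R : Set (Fin k → ℕ)).PairwiseDisjoint QdF :=
    fun x hx y hy hxy => QdF_disj (hRd hx hy hxy)
  have hRQc : (R.biUnion QdF).card = ∑ c ∈ R, (spF c).card := by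
    rw [Finset.card_biUnion (fun a ha b hb hab => hRq ha hb hab)]
    exact Finset.sum_congr rfl (fun c hc => card_QdF c (h3 c (hRM c hc)))
  have hdQ : Disjoint (QdF a ∪ QdF b) (R.biUnion QdF) := by
    rw [Finset.disjoint_union_left, Finset.disjoint_biUnion_right, Finset.disjoint_biUnion_right]
    rw [Finset.disjoint_biUnion_right, Finset.disjoint_biUnion_right] at hdis
    exact ⟨fun c hc => QdF_disj (hdis.1 c hc), fun c hc => QdF_disj (hdis.2 c hc)⟩
  rw [hQ, Finset.card_union_of_disjoint hdQ, hRQc] at hq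
  have hQui := Finset.card_union_add_card_inter (QdF a) (QdF b)
  rw [card_QdF a ha3, card_QdF b hb3] at hQui
  omega

theorem exists_socle {k : ℕ} {lam : Finset (Fin k → ℕ)} {a : Fin k → ℕ} (ha : a ∈ lam) :
    ∃ m ∈ socleFn lam, a ≤ m := by
  obtain ⟨m, ham, hm⟩ := lam.exists_le_maximal ha
  refine ⟨m, ?_, ham⟩
  rw [socleFn, mem_filter]
  exact ⟨hm.1, fun b hb hlt => hm.not_prop_of_gt hlt hb⟩

theorem lam_eq {k : ℕ} {lam : Finset (Fin k → ℕ)} (h : IsPartitionFn lam) :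
    lam = (socleFn lam).biUnion Finset.Iic := by
  ext a
  simp only [mem_biUnion, Finset.mem_Iic]
  constructor
  · exact exists_socle
  · rintro ⟨m, hm, ham⟩
    exact h m (mem_filter.1 hm).1 a ham

theorem deg_one {k : ℕ} {a : Fin k → ℕ} (h : degFn a = 1) : ∃ i, a = Pi.single i 1 := by
  obtain ⟨i, hi⟩ := spF_nonempty a (by omega)
  exact ⟨i, (eq_of_degFn (single_le.2 hi) (by rw [degFn_single]; omega)).symm⟩

theorem card_ones (k : ℕ) :
    ((univ : Finset (Fin k)).image (fun i => (Pi.single i 1 : Fin k → ℕ))).card = k := by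
  rw [Finset.card_image_of_injective, Finset.card_univ, Fintype.card_fin]
  intro i j h
  by_contra hij
  have := congrFun h i
  simp [Pi.single_eq_of_ne hij] at this

theorem forward {k n : ℕ} (hk : k + 2 = 3 * n) {lam : Finset (Fin k → ℕ)} (hp : IsPartitionFn lam)
    (h1 : hsFn lam 1 = k) (hc : (socleFn lam).card = n) (hs : ∀ a ∈ socleFn lam, degFn a = 3)
    (h2 : hsFn lam 2 = k) : socleFn lam ∈ GF k univ n := by
  have hcov : (socleFn lam).biUnion spF = univ := by
    rw [Finset.eq_univ_iff_forall]
    intro i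
    have hsub : lam.filter (fun a => degFn a = 1) ⊆
        (univ : Finset (Fin k)).image (fun i => (Pi.single i 1 : Fin k → ℕ)) := by
      intro a ha
      obtain ⟨i, rfl⟩ := deg_one (mem_filter.1 ha).2
      exact mem_image_of_mem _ (mem_univ i)
    have heq := Finset.eq_of_subset_of_card_le hsub (by rw [card_ones]; exact h1.ge)
    have hi : (Pi.single i 1 : Fin k → ℕ) ∈ lam.filter (fun a => degFn a = 1) := by
      rw [heq]; exact mem_image_of_mem _ (mem_univ i)
    obtain ⟨m, hm, him⟩ := exists_socle (mem_filter.1 hi).1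
    exact mem_biUnion.2 ⟨m, hm, single_le.1 him⟩
  rw [mem_GF]
  refine ⟨hs, hc, ?_, hcov⟩
  apply key_disj _ hs hc
  · rw [hcov]; simpa using hk
  · have : lam.filter (fun a => degFn a = 2) = (socleFn lam).biUnion QdF := by
      ext q
      simp only [mem_filter, mem_biUnion, mem_QdF]
      constructor
      · rintro ⟨hq, hq2⟩
        obtain ⟨m, hm, h⟩ := exists_socle hq
        exact ⟨m, hm, h, hq2⟩
      · rintro ⟨m, hm, h, hq2⟩
        exact ⟨hp m (mem_filter.1 hm).1 q h, hq2⟩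
    rw [← this]
    rw [hsFn] at h2
    omega

theorem backward {k n : ℕ} (hn : 1 ≤ n) {M : Finset (Fin k → ℕ)}
    (hM : M ∈ GF k univ n) :
    let lam := M.biUnion Finset.Iic
    socleFn lam = M ∧ IsPartitionFn lam ∧
        hsFn lam 1 = k ∧ (socleFn lam).card = n ∧
        (∀ a ∈ socleFn lam, degFn a = 3) ∧
        hsFn lam 0 = 1 ∧ hsFn lam 2 = k ∧ hsFn lam 3 = n ∧
        (∀ i, 3 < i → hsFn lam i = 0) := by
  intro lam
  rw [mem_GF] at hM
  obtain ⟨h3, hc, hd, hcov⟩ := hM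
  have hmem : ∀ a, a ∈ lam ↔ ∃ m ∈ M, a ≤ m := by
    intro a; simp [lam]
  have hle : ∀ a ∈ lam, degFn a ≤ 3 := by
    intro a ha
    obtain ⟨m, hm, ham⟩ := (hmem a).1 ha
    rw [← h3 m hm]; exact degFn_mono ham
  have hMl : ∀ m ∈ M, m ∈ lam := fun m hm => (hmem m).2 ⟨m, hm, le_rfl⟩
  have hsoc : socleFn lam = M := by
    ext a
    rw [socleFn, mem_filter]
    constructor
    · rintro ⟨ha, hmax⟩
      obtain ⟨m, hm, ham⟩ := (hmem a).1 ha
      rcases ham.eq_or_lt with rfl | h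
      · exact hm
      · exact absurd h (hmax m (hMl m hm))
    · intro ha
      refine ⟨hMl a ha, fun b hb hlt => ?_⟩
      exact hlt.ne (eq_of_degFn hlt.le (by rw [h3 a ha]; exact hle b hb))
  refine ⟨hsoc, ?_, ?_, by rw [hsoc, hc], by rw [hsoc]; exact h3, ?_, ?_, ?_, ?_⟩
  · intro a ha y hy
    obtain ⟨m, hm, ham⟩ := (hmem a).1 ha
    exact (hmem y).2 ⟨m, hm, hy.trans ham⟩
  · refine Eq.trans ?_ (card_ones k)
    rw [hsFn]
    congr 1
    ext a
    rw [mem_filter, mem_image, hmem]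
    constructor
    · rintro ⟨_, h⟩
      obtain ⟨i, rfl⟩ := deg_one h
      exact ⟨i, mem_univ i, rfl⟩
    · rintro ⟨i, _, rfl⟩
      refine ⟨?_, degFn_single i⟩
      have : i ∈ M.biUnion spF := by rw [hcov]; exact mem_univ i
      obtain ⟨m, hm, him⟩ := mem_biUnion.1 this
      exact ⟨m, hm, single_le.2 him⟩
  · rw [hsFn, Finset.card_eq_one]
    refine ⟨0, ?_⟩
    ext a
    rw [mem_filter, mem_singleton, hmem]
    constructor
    · rintro ⟨_, h⟩
      exact (eq_of_degFn (fun i => Nat.zero_le _) (by rw [h]; exact Nat.zero_le _)).symm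
    · rintro rfl
      obtain ⟨m, hm⟩ : M.Nonempty := by rw [← Finset.card_pos]; omega
      exact ⟨⟨m, hm, fun i => Nat.zero_le _⟩, by simp [degFn]⟩
  · have e : lam.filter (fun a => degFn a = 2) = M.biUnion QdF := by
      ext q
      simp only [mem_filter, mem_biUnion, mem_QdF, hmem]
      constructor
      · rintro ⟨⟨m, hm, h⟩, h2⟩; exact ⟨m, hm, h, h2⟩
      · rintro ⟨m, hm, h, h2⟩; exact ⟨⟨m, hm, h⟩, h2⟩
    rw [hsFn, e, Finset.card_biUnion (fun a ha b hb hab => QdF_disj (hd ha hb hab)),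
      Finset.sum_congr rfl (fun c hc => card_QdF c (h3 c hc)),
      ← Finset.card_biUnion (fun a ha b hb hab => hd ha hb hab), hcov]
    simp
  · rw [hsFn, ← hc]
    congr 1
    ext a
    rw [mem_filter]
    constructor
    · rintro ⟨ha, h⟩
      obtain ⟨m, hm, ham⟩ := (hmem a).1 ha
      rw [eq_of_degFn ham (by rw [h, h3 m hm])]
      exact hm
    · intro ha
      exact ⟨hMl a ha, h3 a ha⟩
  · intro i hi
    rw [hsFn, Finset.card_eq_zero, Finset.eq_empty_iff_forall_notMem]
    intro a ha
    rw [mem_filter] at ha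
    have := hle a ha.1
    omega

theorem main_count {k n : ℕ} (hn : 1 ≤ n) (hk : k + 2 = 3 * n) :
    Set.ncard {lam : Finset (Fin k → ℕ) | IsPartitionFn lam ∧
        hsFn lam 1 = k ∧ (socleFn lam).card = n ∧
        (∀ a ∈ socleFn lam, degFn a = 3) ∧
        hsFn lam 0 = 1 ∧ hsFn lam 2 = k ∧ hsFn lam 3 = n ∧
        (∀ i, 3 < i → hsFn lam i = 0)} = PN n k := by
  have hG := card_GF n (univ : Finset (Fin k))
  rw [Finset.card_univ, Fintype.card_fin, ← Set.ncard_coe_finset] at hG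
  rw [← hG]
  apply Set.ncard_congr (fun lam _ => socleFn lam)
  · rintro lam ⟨h1, h2, h3, h4, -, h5, -⟩
    exact forward hk h1 h2 h3 h4 h5
  · rintro a b ha hb h
    rw [lam_eq ha.1, lam_eq hb.1, h]
  · intro M hM
    have := backward hn (Finset.mem_coe.1 hM)
    exact ⟨_, this.2, this.1⟩


/-- Proposition `prop:max3`: for `n ≥ 1`, the number of partitions
`λ ⊆ ℕ^{3n−2}` with embedding dimension `3n−2`, socle consisting of exactly `n` elements
all of degree 3, and Hilbert–Samuel function `(1, 3n−2, 3n−2, n)`, equals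
`(3n−2)²·(3n−3)!/(6^{n−1}(n−1)!)`. -/
theorem stmt14 (n : ℕ) (hn : 1 ≤ n) :
    Set.ncard {lam : Finset (Fin (3 * n - 2) → ℕ) | IsPartitionFn lam ∧
        hsFn lam 1 = 3 * n - 2 ∧ (socleFn lam).card = n ∧
        (∀ a ∈ socleFn lam, degFn a = 3) ∧
        hsFn lam 0 = 1 ∧ hsFn lam 2 = 3 * n - 2 ∧ hsFn lam 3 = n ∧
        (∀ i, 3 < i → hsFn lam i = 0)} =
      (3 * n - 2) ^ 2 * ((3 * n - 3).factorial / (6 ^ (n - 1) * (n - 1).factorial)) := by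
  obtain ⟨N, rfl⟩ : ∃ N, n = N + 1 := ⟨n - 1, by omega⟩
  rw [main_count hn (by omega), show 3 * (N + 1) - 2 = 3 * N + 1 by omega,
    show 3 * (N + 1) - 3 = 3 * N by omega, Nat.add_sub_cancel]
  exact PN_final N
end
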